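/- arXiv:1803.00700 — 8 statements merged into one kernel-verified Lean document; each statement's English description precedes it below -/
import Mathlib

section
/- Every doubly mixed Ψ : Fin d → Fin d → Fin d → Fin d → ℂ is doubly dilated. -/
open scoped ComplexOrder

/-- `Ψ` is doubly mixed: a convex combination of doubled density matrices. -/
def DoublyMixed {d : ℕ} (Ψ : Fin d → Fin d → Fin d → Fin d → ℂ) : Prop :=
  ∃ (m : ℕ) (ρ : Fin m → Matrix (Fin d) (Fin d) ℂ) (r : Fin m → ℝ),
    (∀ k, (ρ k).PosSemidef) ∧ (∀ k, (ρ k).trace = 1) ∧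
    (∀ k, 0 ≤ r k) ∧ (∑ k, r k = 1) ∧
    ∀ a b c e, Ψ a b c e = ∑ k, (r k : ℂ) * ρ k a b * ρ k c e

/-- `Ψ` is doubly dilated: obtained by twice tracing out part of a doubled tripartite ket. -/
def DoublyDilated {d : ℕ} (Ψ : Fin d → Fin d → Fin d → Fin d → ℂ) : Prop :=
  ∃ (m n : ℕ) (φ : Fin d → Fin m → Fin n → ℂ),
    ∀ a b c e, Ψ a b c e = ∑ i : Fin m, ∑ j : Fin m, ∑ k : Fin n, ∑ l : Fin n,
      φ a i k * star (φ b i l) * φ c j l * star (φ e j k)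

/-- Every doubly mixed `Ψ` is doubly dilated. -/
theorem doublyMixed_doublyDilated {d : ℕ} (Ψ : Fin d → Fin d → Fin d → Fin d → ℂ)
    (hΨ : DoublyMixed Ψ) : DoublyDilated Ψ := by
  obtain ⟨m, ρ, r, hρ, -, hr, -, hΨ⟩ := hΨ
  have hB : ∀ k, ∃ B : Matrix (Fin d) (Fin d) ℂ, ρ k = B.conjTranspose * B := by
    intro k
    open scoped MatrixOrder Matrix.Norms.L2Operator in
    exact CStarAlgebra.nonneg_iff_eq_star_mul_self.mp (hρ k).nonneg
  choose B hB using hB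
  let t : Fin m → ℝ := fun k => √√(r k)
  have ht : ∀ k, ((t k : ℂ) * t k) * (t k * t k) = r k := by
    intro k
    have : (t k * t k) * (t k * t k) = r k := by
      simp only [t]
      rw [Real.mul_self_sqrt (Real.sqrt_nonneg _), Real.mul_self_sqrt (hr k)]
    exact_mod_cast this
  let φ : Fin d → Fin (m * d) → Fin m → ℂ := fun a i k =>
    if (finProdFinEquiv.symm i).1 = k then (t k : ℂ) * star (B k (finProdFinEquiv.symm i).2 a) else 0
  have key : ∀ a b k l, ∑ i, φ a i k * star (φ b i l) =
      if k = l then ((t k : ℂ) * t k) * ρ k a b else 0 := by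
    intro a b k l
    rw [← finProdFinEquiv.sum_comp, Fintype.sum_prod_type, Finset.sum_eq_single k]
    · by_cases h : k = l
      · subst h
        simp only [φ, Equiv.symm_apply_apply, if_true, hB k, Matrix.mul_apply,
          Matrix.conjTranspose_apply, Finset.mul_sum]
        refine Finset.sum_congr rfl fun x _ => ?_
        simp
        ring
      · simp only [φ, Equiv.symm_apply_apply, h, if_false, star_zero, mul_zero, zero_mul, Finset.sum_const_zero]
    · intro x _ hx
      simp only [φ, Equiv.symm_apply_apply, hx, if_false, star_zero, mul_zero, zero_mul, Finset.sum_const_zero]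
    · simp
  refine ⟨m * d, m, φ, fun a b c e => ?_⟩
  have e1 : ∑ i, ∑ j, ∑ k, ∑ l, φ a i k * star (φ b i l) * φ c j l * star (φ e j k) =
      ∑ k, ∑ l, (∑ i, φ a i k * star (φ b i l)) * (∑ j, φ c j l * star (φ e j k)) := by
    simp only [Finset.sum_mul_sum]
    calc _ = ∑ i, ∑ k, ∑ j, ∑ l, φ a i k * star (φ b i l) * φ c j l * star (φ e j k) :=
          Finset.sum_congr rfl fun i _ => Finset.sum_comm
      _ = ∑ k, ∑ i, ∑ j, ∑ l, φ a i k * star (φ b i l) * φ c j l * star (φ e j k) :=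
          Finset.sum_comm
      _ = ∑ k, ∑ i, ∑ l, ∑ j, φ a i k * star (φ b i l) * φ c j l * star (φ e j k) :=
          Finset.sum_congr rfl fun k _ => Finset.sum_congr rfl fun i _ => Finset.sum_comm
      _ = ∑ k, ∑ l, ∑ i, ∑ j, φ a i k * star (φ b i l) * φ c j l * star (φ e j k) :=
          Finset.sum_congr rfl fun k _ => Finset.sum_comm
      _ = _ := by simp only [mul_assoc]
  rw [e1, hΨ]
  refine Finset.sum_congr rfl fun k _ => ?_
  rw [Finset.sum_eq_single k]
  · rw [key, key, if_pos rfl, if_pos rfl, ← ht k]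
    ring
  · intro l _ hl
    rw [key, if_neg (Ne.symm hl), zero_mul]
  · simp
end

section
/- For every d ≥ 2 there exists a doubly dilated Ψ : Fin d → Fin d → Fin d → Fin d → ℂ such that for every real λ > 0, the rescaled vector λ • Ψ is not doubly mixed. -/
open scoped ComplexOrder

/-- The `2 × 2` principal minors of a positive semidefinite matrix are nonnegative. -/
lemma posSemidef_minor {d : ℕ} {ρ : Matrix (Fin d) (Fin d) ℂ} (h : ρ.PosSemidef) (x y : Fin d) :
    ρ x y * ρ y x ≤ ρ x x * ρ y y := by
  have h1 := (h.submatrix ![x, y]).det_nonneg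
  rw [Matrix.det_fin_two] at h1
  simpa using h1

/-- For every `d ≥ 2` there is a doubly dilated `Ψ` no positive rescaling of which
is doubly mixed. -/
theorem exists_doublyDilated_not_doublyMixed (d : ℕ) (hd : 2 ≤ d) :
    ∃ Ψ : Fin d → Fin d → Fin d → Fin d → ℂ,
      DoublyDilated Ψ ∧ ∀ lam : ℝ, 0 < lam → ¬ DoublyMixed (lam • Ψ) := by
  refine ⟨fun a b c e => (if a = e then 1 else 0) * (if b = c then 1 else 0), ?_, ?_⟩
  · refine ⟨1, d, fun a _ k => if a = k then 1 else 0, ?_⟩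
    intro a b c e
    by_cases h1 : a = e <;> by_cases h2 : b = c <;>
      simp [h1, h2, Finset.sum_ite_eq, apply_ite, eq_comm]
  · rintro lam hlam ⟨m, ρ, r, hρ, -, hr, -, hΨ⟩
    obtain ⟨x, y, hxy⟩ : ∃ x y : Fin d, x ≠ y :=
      ⟨⟨0, by omega⟩, ⟨1, by omega⟩, by simp⟩
    have e1 := hΨ x x y y
    have e2 := hΨ x y y x
    have hle : ∑ k, (r k : ℂ) * ρ k x y * ρ k y x ≤ ∑ k, (r k : ℂ) * ρ k x x * ρ k y y := by
      refine Finset.sum_le_sum fun k _ => ?_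
      rw [mul_assoc, mul_assoc]
      exact mul_le_mul_of_nonneg_left (posSemidef_minor (hρ k) x y) (by exact_mod_cast hr k)
    rw [← e1, ← e2] at hle
    simp [hxy] at hle
    have h0 : lam ≤ 0 := by exact_mod_cast hle
    linarith
end

section
/- For every d ≥ 2 and every real λ > 0, the function Ψ : Fin d → Fin d → Fin d → Fin d → ℂ given by Ψ a b c e = λ if a = e and b = c, and Ψ a b c e = 0 otherwise, is not doubly mixed. -/
open scoped ComplexOrder

/-- For `d ≥ 2`, no positive scalar multiple of the cap–cup state is doubly mixed. -/
theorem capCup_not_doublyMixed (d : ℕ) (hd : 2 ≤ d) (lam : ℝ) (hlam : 0 < lam) :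
    ¬ DoublyMixed (fun a b c e : Fin d =>
      if a = e ∧ b = c then (lam : ℂ) else 0) := by
  rintro ⟨m, ρ, r, hρ, -, hr, -, h⟩
  let i : Fin d := ⟨0, by omega⟩
  let j : Fin d := ⟨1, by omega⟩
  have hij : i ≠ j := by simp [i, j]
  have h1 := h i i j j
  have h2 := h i j j i
  simp only [hij, false_and, and_self, if_true, if_false] at h1 h2
  have h3 : (0 : ℂ) ≤ ∑ k, (r k : ℂ) * (ρ k i i * ρ k j j - ρ k i j * ρ k j i) := by
    refine Finset.sum_nonneg fun k _ => mul_nonneg (by exact_mod_cast hr k) ?_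
    have := ((hρ k).submatrix ![i, j]).det_nonneg
    rw [Matrix.det_fin_two] at this
    exact this
  have h4 : ∑ k, (r k : ℂ) * (ρ k i i * ρ k j j - ρ k i j * ρ k j i) = ((-lam : ℝ) : ℂ) := by
    simp only [mul_sub, ← mul_assoc, Finset.sum_sub_distrib]
    rw [← h1, ← h2]
    simp
  rw [h4] at h3
  have h5 : (0 : ℝ) ≤ -lam := by exact_mod_cast h3
  linarith
end

section
/- Let d ≥ 2. There do not exist m : ℕ, weights c : Fin m → ℝ with 0 ≤ c k, and positive semidefinite matrices ρ : Fin m → Matrix (Fin d) (Fin d) ℂ such that for all a b a' b' : Fin d, ∑ k, (c k : ℂ) * ρ k a b * star (ρ k a' b') equals 1 if a = a' and b = b', and 0 otherwise. -/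
open scoped ComplexOrder

/-- For `d ≥ 2`, the identity operator on `ℂ^d ⊗ ℂ^d` is not a nonnegative
combination of rank-one operators `vec(ρ_k) vec(ρ_k)†` with each `ρ_k` positive
semidefinite. -/
theorem identity_not_sum_of_vec_psd (d : ℕ) (hd : 2 ≤ d) :
    ¬ ∃ (m : ℕ) (c : Fin m → ℝ) (ρ : Fin m → Matrix (Fin d) (Fin d) ℂ),
      (∀ k, 0 ≤ c k) ∧ (∀ k, (ρ k).PosSemidef) ∧
      ∀ a b a' b' : Fin d,
        (∑ k, (c k : ℂ) * ρ k a b * star (ρ k a' b')) =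
          if a = a' ∧ b = b' then 1 else 0 := by
  rintro ⟨m, c, ρ, hc, hρ, h⟩
  let i : Fin d := ⟨0, by omega⟩
  let j : Fin d := ⟨1, by omega⟩
  have hij : i ≠ j := by simp [i, j]
  have h1 := h i j i j
  have h0 := h i i j j
  rw [if_pos ⟨rfl, rfl⟩] at h1
  rw [if_neg (fun hh => hij hh.1)] at h0
  have hle : (∑ k, (c k : ℂ) * ρ k i j * star (ρ k i j)) ≤
      ∑ k, (c k : ℂ) * ρ k i i * star (ρ k j j) := by
    refine Finset.sum_le_sum fun k _ => ?_
    have hdet := ((hρ k).submatrix ![i, j]).det_nonneg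
    rw [Matrix.det_fin_two] at hdet
    simp only [Matrix.submatrix_apply, Matrix.cons_val_zero, Matrix.cons_val_one] at hdet
    rw [← (hρ k).isHermitian.apply j i] at hdet
    rw [(hρ k).isHermitian.apply j j, mul_assoc, mul_assoc]
    exact mul_le_mul_of_nonneg_left (sub_nonneg.mp hdet) (by exact_mod_cast hc k)
  rw [h1, h0] at hle
  exact absurd hle (not_le_of_gt zero_lt_one)
end

section
/- Let d ≥ 2. There do not exist m : ℕ, weights c : Fin m → ℝ with 0 ≤ c k, and positive semidefinite matrices ρ : Fin m → Matrix (Fin d) (Fin d) ℂ such that for all a b a' b' : Fin d, ∑ k, (c k : ℂ) * ρ k a a' * ρ k b' b equals 1 if a = b and a' = b', and 0 otherwise. -/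
open scoped ComplexOrder

/-- For `d ≥ 2`, the cap-composed-with-cup operator on `ℂ^d ⊗ ℂ^d` is not a
nonnegative combination `∑ k, c k • (ρ_k ⊗ (ρ_k)ᵀ)` with each `ρ_k` positive
semidefinite. -/
theorem capCup_not_sum_of_psd_tensor (d : ℕ) (hd : 2 ≤ d) :
    ¬ ∃ (m : ℕ) (c : Fin m → ℝ) (ρ : Fin m → Matrix (Fin d) (Fin d) ℂ),
      (∀ k, 0 ≤ c k) ∧ (∀ k, (ρ k).PosSemidef) ∧
      ∀ a b a' b' : Fin d,
        (∑ k, (c k : ℂ) * ρ k a a' * ρ k b' b) =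
          if a = b ∧ a' = b' then 1 else 0 := by
  rintro ⟨m, c, ρ, hc, hρ, h⟩
  let i : Fin d := ⟨0, by omega⟩
  let j : Fin d := ⟨1, by omega⟩
  have hij : i ≠ j := by simp [i, j]
  have h1 := h i i j j
  have h0 := h i j i j
  rw [if_pos ⟨rfl, rfl⟩] at h1
  rw [if_neg (fun hh => hij hh.1)] at h0
  have hle : (∑ k, (c k : ℂ) * ρ k i j * ρ k j i) ≤ ∑ k, (c k : ℂ) * ρ k i i * ρ k j j := by
    refine Finset.sum_le_sum fun k _ => ?_
    have hdet := ((hρ k).submatrix ![i, j]).det_nonneg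
    rw [Matrix.det_fin_two] at hdet
    simp only [Matrix.submatrix_apply, Matrix.cons_val_zero, Matrix.cons_val_one] at hdet
    rw [mul_assoc, mul_assoc]
    exact mul_le_mul_of_nonneg_left (sub_nonneg.mp hdet) (by exact_mod_cast hc k)
  rw [h1, h0] at hle
  exact absurd hle (not_le_of_gt zero_lt_one)
end

section
/- If Ψ : Fin d → Fin d → Fin d → Fin d → ℂ is doubly mixed, then both CJ₁ Ψ and CJ₂ Ψ are positive semidefinite matrices. -/
open scoped ComplexOrder

/-- The first Choi–Jamiolkowski operator of `Ψ`: `CJ₁ Ψ (a, b) (c, e) = Ψ a b e c`. -/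
def CJ1 {d : ℕ} (Ψ : Fin d → Fin d → Fin d → Fin d → ℂ) :
    Matrix (Fin d × Fin d) (Fin d × Fin d) ℂ :=
  fun p q => Ψ p.1 p.2 q.2 q.1

/-- The second Choi–Jamiolkowski operator of `Ψ`: `CJ₂ Ψ (a, b) (c, e) = Ψ a c e b`. -/
def CJ2 {d : ℕ} (Ψ : Fin d → Fin d → Fin d → Fin d → ℂ) :
    Matrix (Fin d × Fin d) (Fin d × Fin d) ℂ :=
  fun p q => Ψ p.1 q.1 q.2 p.2

/-- If `Ψ` is doubly mixed, then both its Choi–Jamiolkowski operators are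
positive semidefinite. -/
theorem doublyMixed_CJ_posSemidef {d : ℕ} (Ψ : Fin d → Fin d → Fin d → Fin d → ℂ)
    (hΨ : DoublyMixed Ψ) : (CJ1 Ψ).PosSemidef ∧ (CJ2 Ψ).PosSemidef := by
  obtain ⟨m, ρ, r, hρ, -, hr, -, h⟩ := hΨ
  have hr' : ∀ k, (0 : ℂ) ≤ (r k : ℂ) := fun k => by exact_mod_cast hr k
  constructor
  · have e : CJ1 Ψ = ∑ k, (r k : ℂ) • Matrix.vecMulVec (fun p : Fin d × Fin d => ρ k p.1 p.2)
        (star (fun p : Fin d × Fin d => ρ k p.1 p.2)) := by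
      ext p q
      simp only [CJ1, h, Matrix.sum_apply, Matrix.smul_apply, Matrix.vecMulVec_apply,
        Pi.star_apply, smul_eq_mul]
      refine Finset.sum_congr rfl fun k _ => ?_
      rw [(hρ k).1.apply, mul_assoc]
    rw [e]
    exact Matrix.posSemidef_sum _ fun k _ =>
      (Matrix.posSemidef_vecMulVec_self_star _).smul (hr' k)
  · have e : CJ2 Ψ = ∑ k, (r k : ℂ) • Matrix.kroneckerMap (· * ·) (ρ k) (ρ k).transpose := by
      ext p q
      simp only [CJ2, h, Matrix.sum_apply, Matrix.smul_apply, Matrix.kroneckerMap_apply,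
        Matrix.transpose_apply, smul_eq_mul, mul_assoc]
    rw [e]
    exact Matrix.posSemidef_sum _ fun k _ =>
      ((hρ k).kronecker (hρ k).transpose).smul (hr' k)
end

section
/- If Ψ : Fin d → Fin d → Fin d → Fin d → ℂ is doubly dilated, then CJ₁ Ψ is a positive semidefinite matrix (in particular it is Hermitian). -/
open scoped ComplexOrder

/-- If `Ψ` is doubly dilated, then its first Choi–Jamiolkowski operator is
positive semidefinite (in particular Hermitian). -/
theorem doublyDilated_CJ1_posSemidef {d : ℕ} (Ψ : Fin d → Fin d → Fin d → Fin d → ℂ)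
    (hΨ : DoublyDilated Ψ) : (CJ1 Ψ).PosSemidef := by
  obtain ⟨m, n, φ, h⟩ := hΨ
  have key : CJ1 Ψ =
      (Matrix.of fun (p : Fin d × Fin d) (q : Fin n × Fin n) =>
        ∑ i : Fin m, φ p.1 i q.1 * star (φ p.2 i q.2)) *
      (Matrix.of fun (p : Fin d × Fin d) (q : Fin n × Fin n) =>
        ∑ i : Fin m, φ p.1 i q.1 * star (φ p.2 i q.2)).conjTranspose := by
    ext p q
    have e1 : ∀ f : Fin m → Fin m → Fin n → Fin n → ℂ,
        ∑ i, ∑ j, ∑ k, ∑ l, f i j k l = ∑ x : Fin n × Fin n, ∑ i, ∑ j, f i j x.1 x.2 := by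
      intro f
      symm
      rw [Finset.sum_comm]
      refine Finset.sum_congr rfl fun i _ => ?_
      rw [Finset.sum_comm]
      refine Finset.sum_congr rfl fun j _ => ?_
      rw [Fintype.sum_prod_type]
    simp only [CJ1, h, Matrix.mul_apply, Matrix.conjTranspose_apply, Matrix.of_apply]
    rw [e1]
    refine Finset.sum_congr rfl fun x _ => ?_
    rw [star_sum, Finset.sum_mul_sum]
    refine Finset.sum_congr rfl fun i _ => Finset.sum_congr rfl fun j _ => ?_
    rw [star_mul', star_star]
    ring
  rw [key]
  exact Matrix.posSemidef_self_mul_conjTranspose _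
end

section
/- If Ψ : Fin d → Fin d → Fin d → Fin d → ℂ is doubly dilated, then CJ₂ Ψ is a positive semidefinite matrix (in particular it is Hermitian). -/
open scoped ComplexOrder

/-- If `Ψ` is doubly dilated, then its second Choi–Jamiolkowski operator is
positive semidefinite (in particular Hermitian). -/
theorem doublyDilated_CJ2_posSemidef {d : ℕ} (Ψ : Fin d → Fin d → Fin d → Fin d → ℂ)
    (hΨ : DoublyDilated Ψ) : (CJ2 Ψ).PosSemidef := by
  obtain ⟨m, n, φ, h⟩ := hΨ
  have key : CJ2 Ψ = (Matrix.of fun (p : Fin d × Fin d) (q : Fin m × Fin m) =>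
      ∑ k, φ p.1 q.1 k * star (φ p.2 q.2 k)) *
      (Matrix.of fun (p : Fin d × Fin d) (q : Fin m × Fin m) =>
      ∑ k, φ p.1 q.1 k * star (φ p.2 q.2 k)).conjTranspose := by
    ext ⟨a, b⟩ ⟨c, e⟩
    simp only [CJ2, h, Matrix.mul_apply, Matrix.conjTranspose_apply, Matrix.of_apply,
      Fintype.sum_prod_type, star_sum, star_mul', star_star, Finset.sum_mul_sum]
    refine Finset.sum_congr rfl fun i _ => Finset.sum_congr rfl fun j _ =>
      Finset.sum_congr rfl fun k _ => Finset.sum_congr rfl fun l _ => ?_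
    ring
  rw [key]
  exact Matrix.posSemidef_self_mul_conjTranspose _
end
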